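/- Let k be a field and let R = k[x, y, x₁, y₁, x₂, y₂] be the polynomial ring in six variables. Then the ideal of R generated by all 3 × 3 minors of the 3 × 6 matrix with rows (x, y, 0, 0, 0, 0), (x₁, y₁, x, y, 0, 0), and (x₂, y₂, x₁, y₁, x, y) is equal to the ideal 𝔞₀·𝔞₁ + (y₂x² − y x₂ x − x₁ y₁ x + y x₁², x₂ y² − x₁ y₁ y − x y₂ y + x y₁²), where 𝔞₀ = (x, y) and 𝔞₁ = (x², xy, y², x y₁ − y x₁). Explicitly, this ideal is generated by x³, x²y, xy², y³, x(x y₁ − y x₁), y(x y₁ − y x₁), y₂x² − y x₂ x − x₁ y₁ x + y x₁², and x₂ y² − x₁ y₁ y − x y₂ y + x y₁². -/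

import Mathlib

open MvPolynomial

/-- The `3 × 6` block Toeplitz matrix of the second jet of `[a  b]`. -/
def jetMatrix {A : Type*} [CommRing A] (a b c d e f : A) : Matrix (Fin 3) (Fin 6) A :=
  Matrix.of ![![a, b, 0, 0, 0, 0], ![c, d, a, b, 0, 0], ![e, f, c, d, a, b]]

theorem det_submatrix_jetMatrix_eq_zero {A : Type*} [CommRing A] {a b c d e f : A}
    (h₁ : a ^ 3 = 0) (h₂ : a ^ 2 * b = 0) (h₃ : a * b ^ 2 = 0) (h₄ : b ^ 3 = 0)
    (h₅ : a * (a * d - b * c) = 0) (h₆ : b * (a * d - b * c) = 0)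
    (h₇ : f * a ^ 2 - b * e * a - c * d * a + b * c ^ 2 = 0)
    (h₈ : e * b ^ 2 - c * d * b - a * f * b + a * d ^ 2 = 0) (s : Fin 3 → Fin 6) :
    ((jetMatrix a b c d e f).submatrix id s).det = 0 := by
  rw [Matrix.det_fin_three]
  simp only [Matrix.submatrix_apply, id]
  generalize s 0 = i, s 1 = j, s 2 = l
  fin_cases i <;> fin_cases j <;> fin_cases l <;> simp [jetMatrix] <;> grind

/-- In `R = k[x, y, x₁, y₁, x₂, y₂]` (with `x = X 0`, `y = X 1`, `x₁ = X 2`, `y₁ = X 3`,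
`x₂ = X 4`, `y₂ = X 5`), the ideal generated by the `3 × 3` minors of the matrix
`[[x, y, 0, 0, 0, 0], [x₁, y₁, x, y, 0, 0], [x₂, y₂, x₁, y₁, x, y]]` equals the ideal
generated by `x³, x²y, xy², y³, x(x y₁ − y x₁), y(x y₁ − y x₁),
y₂x² − y x₂ x − x₁ y₁ x + y x₁², x₂ y² − x₁ y₁ y − x y₂ y + x y₁²`. -/
theorem minors_ideal_jet2 (k : Type*) [Field k] :
    Ideal.span { d : MvPolynomial (Fin 6) k |
        ∃ c : Fin 3 ↪ Fin 6,
          d = (Matrix.submatrix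
              (Matrix.of ![![X 0, X 1, 0, 0, 0, 0],
                           ![X 2, X 3, X 0, X 1, 0, 0],
                           ![X 4, X 5, X 2, X 3, X 0, X 1]]) id c).det }
      = Ideal.span { (X 0 : MvPolynomial (Fin 6) k) ^ 3, X 0 ^ 2 * X 1, X 0 * X 1 ^ 2,
          X 1 ^ 3,
          X 0 * (X 0 * X 3 - X 1 * X 2), X 1 * (X 0 * X 3 - X 1 * X 2),
          X 5 * X 0 ^ 2 - X 1 * X 4 * X 0 - X 2 * X 3 * X 0 + X 1 * X 2 ^ 2,
          X 4 * X 1 ^ 2 - X 2 * X 3 * X 1 - X 0 * X 5 * X 1 + X 0 * X 3 ^ 2 } := by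
  apply le_antisymm
  · rw [Ideal.span_le]
    rintro _ ⟨s, rfl⟩
    rw [SetLike.mem_coe, ← Ideal.Quotient.eq_zero_iff_mem, RingHom.map_det]
    generalize hI : Ideal.span (α := MvPolynomial (Fin 6) k) _ = I
    have hmem : ∀ p ∈ _, Ideal.Quotient.mk I p = 0 := fun p hp =>
      Ideal.Quotient.eq_zero_iff_mem.2 (hI ▸ Ideal.subset_span hp)
    simp only [Set.mem_insert_iff, Set.mem_singleton_iff, forall_eq_or_imp, forall_eq, map_add,
      map_sub, map_mul, map_pow] at hmem
    obtain ⟨h₁, h₂, h₃, h₄, h₅, h₆, h₇, h₈⟩ := hmem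
    rw [← det_submatrix_jetMatrix_eq_zero h₁ h₂ h₃ h₄ h₅ h₆ h₇ h₈ s]
    congr 1
    ext i j
    simp only [RingHom.mapMatrix_apply, Matrix.map_apply, Matrix.submatrix_apply, id]
    generalize s j = l
    fin_cases i <;> fin_cases l <;> simp [jetMatrix]
  · have minor_mem {p : MvPolynomial (Fin 6) k} (s : Fin 3 → Fin 6) (hs : s.Injective)
        (hp : p = ((jetMatrix (X 0) (X 1) (X 2) (X 3) (X 4) (X 5)).submatrix id s).det) :
        p ∈ Ideal.span { d : MvPolynomial (Fin 6) k | ∃ c : Fin 3 ↪ Fin 6,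
          d = ((jetMatrix (X 0) (X 1) (X 2) (X 3) (X 4) (X 5)).submatrix id c).det } :=
      Ideal.subset_span ⟨⟨s, hs⟩, hp⟩
    rw [Ideal.span_le]
    simp only [Set.insert_subset_iff, Set.singleton_subset_iff, SetLike.mem_coe]
    refine ⟨?_, ?_, ?_, ?_, ?_, ?_, ?_, ?_⟩
    · refine minor_mem ![0, 2, 4] (by decide) ?_
      simp [jetMatrix, Matrix.det_fin_three]
      ring
    · refine minor_mem ![0, 2, 5] (by decide) ?_
      simp [jetMatrix, Matrix.det_fin_three]
      ring
    · refine minor_mem ![0, 3, 5] (by decide) ?_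
      simp [jetMatrix, Matrix.det_fin_three]
      ring
    · refine minor_mem ![1, 3, 5] (by decide) ?_
      simp [jetMatrix, Matrix.det_fin_three]
      ring
    · refine minor_mem ![0, 1, 4] (by decide) ?_
      simp [jetMatrix, Matrix.det_fin_three]
      ring
    · refine minor_mem ![0, 1, 5] (by decide) ?_
      simp [jetMatrix, Matrix.det_fin_three]
      ring
    · refine neg_mem_iff.1 (minor_mem ![0, 1, 2] (by decide) ?_)
      simp [jetMatrix, Matrix.det_fin_three]
      ring
    · refine minor_mem ![0, 1, 3] (by decide) ?_
      simp [jetMatrix, Matrix.det_fin_three]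
      ring
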